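/- Let m > 0, ν ∈ [0, 1/m), λ ≤ 0, and let c > 0 satisfy (1 − 2λ)·J_ν(2c/m) + 2c·J′_ν(2c/m) = 0 with 2c/m ∈ (0, j_ν). Let a < b and let g be a continuously differentiable function on [a, b] with g(a) = g(b) = 0. Then ((1 − ν²m²)/4)·∫ₐᵇ |g(x)|²/δ(x)² dx + (c²/δ₀^m)·∫ₐᵇ |g(x)|²/δ(x)^{2−m} dx ≤ (2(1 + νm) + |λ|)·∫ₐᵇ |g′(x)|² dx. -/

import Mathlib

open MeasureTheory Real Set Filter

/-- Bessel function of the first kind of real order `ν`, defined for `x > 0` by its series. -/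
noncomputable def besselJ (ν x : ℝ) : ℝ :=
  ∑' k : ℕ, (-1 : ℝ) ^ k * x ^ (2 * (k : ℝ) + ν) /
    (2 ^ (2 * (k : ℝ) + ν) * (Nat.factorial k : ℝ) * Real.Gamma ((k : ℝ) + 1 + ν))


lemma summable_mul_pow_of_le_div_factorial {α : ℕ → ℝ} {C : ℝ}
    (hα : ∀ k, |α k| ≤ C / k.factorial) (y : ℝ) : Summable fun k : ℕ => α k * y ^ k := by
  refine Summable.of_norm_bounded ((Real.summable_pow_div_factorial |y|).mul_left C) fun k => ?_
  rw [norm_mul, norm_pow, Real.norm_eq_abs, Real.norm_eq_abs]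
  calc |α k| * |y| ^ k ≤ C / k.factorial * |y| ^ k := by gcongr; exact hα k
    _ = C * (|y| ^ k / k.factorial) := by ring

/-- A real power series whose coefficients are dominated by `C / k!` may be differentiated
term by term. -/
lemma hasDerivAt_tsum_mul_pow {α : ℕ → ℝ} {C : ℝ} (hα : ∀ k, |α k| ≤ C / k.factorial) (y : ℝ) :
    HasDerivAt (fun z : ℝ => ∑' k, α k * z ^ k) (∑' k : ℕ, ((k : ℝ) + 1) * α (k + 1) * y ^ k) y := by
  have hC : 0 ≤ C := by simpa using (abs_nonneg _).trans (hα 0)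
  set r : ℝ := |y| + 1 with hr
  have hr0 : 0 ≤ r := by positivity
  have hbound : Summable fun k : ℕ => (k : ℝ) * (C / k.factorial) * r ^ (k - 1) := by
    rw [← summable_nat_add_iff 1]
    refine ((Real.summable_pow_div_factorial r).mul_left C).congr fun k => ?_
    rw [Nat.factorial_succ]
    rw [Nat.add_sub_cancel]
    push_cast
    field_simp
  have hterm : ∀ (k : ℕ) (z : ℝ), z ∈ Metric.ball (0 : ℝ) r →
      ‖α k * (k * z ^ (k - 1))‖ ≤ (k : ℝ) * (C / k.factorial) * r ^ (k - 1) := by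
    intro k z hz
    have hz' : |z| ≤ r := by simpa using (mem_ball_zero_iff.1 hz).le
    rw [norm_mul, norm_mul, norm_pow, Real.norm_eq_abs, Real.norm_eq_abs, Real.norm_eq_abs,
      Nat.abs_cast]
    calc |α k| * (k * |z| ^ (k - 1)) ≤ C / k.factorial * (k * r ^ (k - 1)) := by
          gcongr; exact hα k
      _ = _ := by ring
  have hy : y ∈ Metric.ball (0 : ℝ) r := by
    rw [mem_ball_zero_iff, Real.norm_eq_abs]; linarith
  have key := hasDerivAt_tsum_of_isPreconnected hbound Metric.isOpen_ball
    (convex_ball (0 : ℝ) r).isPreconnected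
    (fun k z _ => (hasDerivAt_pow k z).const_mul (α k)) hterm hy
    (summable_mul_pow_of_le_div_factorial hα y) hy
  have hs : Summable fun k : ℕ => α k * (k * y ^ (k - 1)) :=
    Summable.of_norm_bounded hbound fun k => hterm k y hy
  refine key.congr_deriv ?_
  rw [hs.tsum_eq_zero_add]
  simp only [Nat.cast_zero, zero_mul, mul_zero, zero_add, Nat.add_sub_cancel]
  exact tsum_congr fun k => by push_cast; ring

lemma abs_succ_mul_le_div_factorial {α : ℕ → ℝ} {C : ℝ} (hα : ∀ k, |α k| ≤ C / k.factorial)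
    (k : ℕ) : |((k : ℝ) + 1) * α (k + 1)| ≤ C / k.factorial := by
  rw [abs_mul, abs_of_nonneg (by positivity : (0 : ℝ) ≤ (k : ℝ) + 1)]
  calc ((k : ℝ) + 1) * |α (k + 1)| ≤ ((k : ℝ) + 1) * (C / (k + 1).factorial) := by
        gcongr; exact hα (k + 1)
    _ = C / k.factorial := by
        rw [Nat.factorial_succ]; push_cast; field_simp

/-- The coefficients of the entire function `h` with `J_ν(t) = (t / 2) ^ ν * h (t ^ 2)`. -/
noncomputable def besselCoeff (ν : ℝ) (k : ℕ) : ℝ :=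
  (-1) ^ k / (4 ^ k * (k.factorial : ℝ) * Real.Gamma ((k : ℝ) + 1 + ν))

lemma gamma_one_add_le {ν : ℝ} (hν : 0 ≤ ν) (k : ℕ) :
    Real.Gamma (1 + ν) ≤ Real.Gamma ((k : ℝ) + 1 + ν) := by
  induction k with
  | zero => simp
  | succ k ih =>
    have h0 : (0 : ℝ) < (k : ℝ) + 1 + ν := by positivity
    have h1 := Real.Gamma_pos_of_pos h0
    have h2 := Real.Gamma_add_one h0.ne'
    have h3 : ((k + 1 : ℕ) : ℝ) + 1 + ν = (k : ℝ) + 1 + ν + 1 := by push_cast; ring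
    rw [h3, h2]
    have hk : (0 : ℝ) ≤ k := by positivity
    nlinarith

lemma abs_besselCoeff_le {ν : ℝ} (hν : 0 ≤ ν) (k : ℕ) :
    |besselCoeff ν k| ≤ (1 / Real.Gamma (1 + ν)) / k.factorial := by
  have h1 : 0 < Real.Gamma (1 + ν) := Real.Gamma_pos_of_pos (by positivity)
  have h2 := gamma_one_add_le hν k
  have h3 : (1 : ℝ) ≤ 4 ^ k := one_le_pow₀ (by norm_num)
  have h4 : 0 < Real.Gamma ((k : ℝ) + 1 + ν) := h1.trans_le h2
  have hf : (0 : ℝ) < k.factorial := by positivity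
  rw [besselCoeff, abs_div, abs_pow, abs_neg, abs_one, one_pow, abs_of_pos (by positivity),
    div_div]
  refine one_div_le_one_div_of_le (by positivity) ?_
  calc Real.Gamma (1 + ν) * k.factorial ≤ Real.Gamma ((k : ℝ) + 1 + ν) * k.factorial := by gcongr
    _ ≤ 4 ^ k * (Real.Gamma ((k : ℝ) + 1 + ν) * k.factorial) :=
        le_mul_of_one_le_left (by positivity) h3
    _ = _ := by ring

lemma besselCoeff_succ {ν : ℝ} (hν : 0 ≤ ν) (k : ℕ) :
    4 * ((k : ℝ) + 1) * ((k : ℝ) + 1 + ν) * besselCoeff ν (k + 1) = -besselCoeff ν k := by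
  have h0 : (0 : ℝ) < (k : ℝ) + 1 + ν := by positivity
  have h1 := Real.Gamma_pos_of_pos h0
  have h3 : ((k + 1 : ℕ) : ℝ) + 1 + ν = (k : ℝ) + 1 + ν + 1 := by push_cast; ring
  rw [besselCoeff, besselCoeff, h3, Real.Gamma_add_one h0.ne', Nat.factorial_succ]
  push_cast
  field_simp
  ring

/-- The entire function `h` with `J_ν(t) = (t / 2) ^ ν * h (t ^ 2)`. -/
noncomputable def besselEntire (ν y : ℝ) : ℝ := ∑' k, besselCoeff ν k * y ^ k

/-- `besselEntire` solves `4 y h'' + 4 (ν + 1) h' + h = 0`. -/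
lemma exists_hasDerivAt_besselEntire {ν : ℝ} (hν : 0 ≤ ν) :
    ∃ h' h'' : ℝ → ℝ, (∀ y, HasDerivAt (besselEntire ν) (h' y) y) ∧
      (∀ y, HasDerivAt h' (h'' y) y) ∧
      ∀ y, 4 * y * h'' y + 4 * (ν + 1) * h' y + besselEntire ν y = 0 := by
  have b0 := abs_besselCoeff_le hν
  have b1 := abs_succ_mul_le_div_factorial b0
  have b2 := abs_succ_mul_le_div_factorial b1
  refine ⟨fun y => ∑' k : ℕ, ((k : ℝ) + 1) * besselCoeff ν (k + 1) * y ^ k,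
    fun y => ∑' k : ℕ, ((k : ℝ) + 1) *
      ((((k + 1 : ℕ) : ℝ) + 1) * besselCoeff ν (k + 1 + 1)) * y ^ k,
    hasDerivAt_tsum_mul_pow b0, hasDerivAt_tsum_mul_pow b1, fun y => ?_⟩
  have s0 := summable_mul_pow_of_le_div_factorial b0 y
  have s1 := summable_mul_pow_of_le_div_factorial b1 y
  have s2 := summable_mul_pow_of_le_div_factorial b2 y
  have s2' : Summable fun k : ℕ => (k : ℝ) * (((k : ℝ) + 1) * besselCoeff ν (k + 1)) * y ^ k := by
    rw [← summable_nat_add_iff 1]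
    refine (s2.mul_left y).congr fun k => ?_
    push_cast
    ring
  have e2 : y * ∑' k : ℕ, ((k : ℝ) + 1) *
      ((((k + 1 : ℕ) : ℝ) + 1) * besselCoeff ν (k + 1 + 1)) * y ^ k =
      ∑' k : ℕ, (k : ℝ) * (((k : ℝ) + 1) * besselCoeff ν (k + 1)) * y ^ k := by
    rw [s2'.tsum_eq_zero_add, ← tsum_mul_left]
    simp only [Nat.cast_zero, zero_mul, zero_add]
    exact tsum_congr fun k => by push_cast; ring
  rw [mul_assoc, e2, besselEntire, ← tsum_mul_left, ← tsum_mul_left,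
    ← (s2'.mul_left 4).tsum_add (s1.mul_left _),
    ← ((s2'.mul_left 4).add (s1.mul_left (4 * (ν + 1)))).tsum_add s0]
  refine (tsum_congr fun k => ?_).trans tsum_zero
  linear_combination (y ^ k) * besselCoeff_succ hν k

lemma besselEntire_zero_pos {ν : ℝ} (hν : 0 ≤ ν) : 0 < besselEntire ν 0 := by
  rw [besselEntire, tsum_eq_single 0 (fun k hk => by simp [hk])]
  have : 0 < Real.Gamma (1 + ν) := Real.Gamma_pos_of_pos (by positivity)
  simpa [besselCoeff] using this

lemma besselJ_eq_rpow_mul {ν t : ℝ} (ht : 0 < t) :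
    besselJ ν t = (t / 2) ^ ν * besselEntire ν (t ^ 2) := by
  rw [besselJ, besselEntire, ← tsum_mul_left]
  refine tsum_congr fun k => ?_
  have h1 : t ^ (2 * (k : ℝ) + ν) = (t ^ 2) ^ k * t ^ ν := by
    rw [Real.rpow_add ht, ← pow_mul, ← Real.rpow_natCast t (2 * k)]; push_cast; rfl
  have h2 : (2 : ℝ) ^ (2 * (k : ℝ) + ν) = 4 ^ k * 2 ^ ν := by
    rw [Real.rpow_add two_pos, ← Real.rpow_natCast 4 k, Real.rpow_mul two_pos.le]; norm_num
  rw [h1, h2, Real.div_rpow ht.le two_pos.le, besselCoeff]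
  ring

/-- The logarithmic derivative of `J_ν` in terms of that of `besselEntire`. -/
lemma deriv_besselJ_mul {ν t h' : ℝ} (ht : 0 < t)
    (hh : HasDerivAt (besselEntire ν) h' (t ^ 2)) :
    t * deriv (besselJ ν) t = (t / 2) ^ ν * (ν * besselEntire ν (t ^ 2) + 2 * t ^ 2 * h') := by
  have e : besselJ ν =ᶠ[nhds t] fun s => (s / 2) ^ ν * besselEntire ν (s ^ 2) := by
    filter_upwards [lt_mem_nhds ht] with s hs using besselJ_eq_rpow_mul hs
  have d1 : HasDerivAt (fun s : ℝ => (s / 2) ^ ν) (1 / 2 * ν * (t / 2) ^ (ν - 1)) t :=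
    ((hasDerivAt_id t).div_const 2).rpow_const (Or.inl (by positivity))
  have d2 : HasDerivAt (fun s : ℝ => besselEntire ν (s ^ 2)) (h' * (2 * t)) t := by
    have h1 : HasDerivAt (fun s : ℝ => s ^ 2) (2 * t) t := by simpa using hasDerivAt_pow 2 t
    exact HasDerivAt.comp (h := fun s : ℝ => s ^ 2) t hh h1
  rw [e.deriv_eq, (d1.fun_mul d2).deriv, Real.rpow_sub_one (by positivity)]
  field_simp

/-- A one-sided Hardy inequality from a solution `W / x` of a Riccati equation. -/
lemma hardy_of_riccati {d m A B l : ℝ} {W W' f f' : ℝ → ℝ} (hd : 0 < d) (hm : 0 < m)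
    (hl : l ≤ 0)
    (hWc : ContinuousOn W (Icc 0 d)) (hW : ∀ x ∈ Ioo 0 d, HasDerivAt W (W' x) x)
    (hric : ∀ x ∈ Ioo 0 d, x * W' x - W x + W x ^ 2 = -(A + B * x ^ m)) (hWd : W d = l)
    (hf : ∀ x ∈ Icc 0 d, HasDerivAt f (f' x) x) (hf' : ContinuousOn f' (Icc 0 d))
    (hf0 : f 0 = 0) :
    IntervalIntegrable (fun x => |f x| ^ 2 / x ^ 2) volume 0 d ∧
    IntervalIntegrable (fun x => |f x| ^ 2 / x ^ ((2 : ℝ) - m)) volume 0 d ∧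
    A * (∫ x in (0 : ℝ)..d, |f x| ^ 2 / x ^ 2)
      + B * (∫ x in (0 : ℝ)..d, |f x| ^ 2 / x ^ ((2 : ℝ) - m))
      ≤ (1 + |l|) * ∫ x in (0 : ℝ)..d, |f' x| ^ 2 := by
  set s : ℝ → ℝ := dslope f 0 with hs
  have hsc : ContinuousOn s (Icc 0 d) := by
    intro x hx
    refine ContinuousAt.continuousWithinAt ?_
    rcases eq_or_ne x 0 with rfl | hx0
    · exact continuousAt_dslope_same.2 (hf 0 hx).differentiableAt
    · exact (continuousAt_dslope_of_ne hx0).2 (hf x hx).continuousAt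
  have hfs : ∀ x, f x = x * s x := by
    intro x
    have := sub_smul_dslope f 0 x
    simpa [hf0] using this.symm
  have hpow : ContinuousOn (fun x : ℝ => x ^ m) (Icc 0 d) :=
    (Real.continuous_rpow_const hm.le).continuousOn
  have e1 : ∀ x ∈ Ioc 0 d, |f x| ^ 2 / x ^ 2 = s x ^ 2 := by
    intro x hx
    have := hx.1.ne'
    rw [sq_abs, hfs]; field_simp
  have e2 : ∀ x ∈ Ioc 0 d, |f x| ^ 2 / x ^ ((2 : ℝ) - m) = x ^ m * s x ^ 2 := by
    intro x hx
    have := hx.1.ne'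
    have := (Real.rpow_pos_of_pos hx.1 m).ne'
    rw [sq_abs, hfs, Real.rpow_sub hx.1, Real.rpow_two]; field_simp
  have c1 : ContinuousOn (fun x => s x ^ 2) (Icc 0 d) := hsc.pow 2
  have c2 : ContinuousOn (fun x => x ^ m * s x ^ 2) (Icc 0 d) := hpow.mul c1
  have c3 : ContinuousOn (fun x => f' x ^ 2) (Icc 0 d) := hf'.pow 2
  have i1 := c1.intervalIntegrable_of_Icc (μ := volume) hd.le
  have i2 := c2.intervalIntegrable_of_Icc (μ := volume) hd.le
  have i3 := c3.intervalIntegrable_of_Icc (μ := volume) hd.le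
  refine ⟨i1.congr ?_, i2.congr ?_, ?_⟩
  · rw [uIoc_of_le hd.le]; exact fun x hx => (e1 x hx).symm
  · rw [uIoc_of_le hd.le]; exact fun x hx => (e2 x hx).symm
  have E1 : ∫ x in (0 : ℝ)..d, |f x| ^ 2 / x ^ 2 = ∫ x in (0 : ℝ)..d, s x ^ 2 :=
    intervalIntegral.integral_congr_Ioo_of_le hd.le fun x hx => e1 x (Ioo_subset_Ioc_self hx)
  have E2 : ∫ x in (0 : ℝ)..d, |f x| ^ 2 / x ^ ((2 : ℝ) - m) =
      ∫ x in (0 : ℝ)..d, x ^ m * s x ^ 2 :=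
    intervalIntegral.integral_congr_Ioo_of_le hd.le fun x hx => e2 x (Ioo_subset_Ioc_self hx)
  simp only [sq_abs]
  simp only [sq_abs] at E1 E2
  rw [E1, E2]
  -- the endpoint value is controlled by the Dirichlet integral
  have hend : f d ^ 2 / d ≤ ∫ x in (0 : ℝ)..d, f' x ^ 2 := by
    set k := f d / d with hk
    have hder : ∀ x ∈ Icc 0 d, HasDerivAt (fun x => 2 * k * f x - k ^ 2 * x)
        (2 * k * f' x - k ^ 2 * 1) x := fun x hx =>
      ((hf x hx).const_mul _).sub ((hasDerivAt_id x).const_mul _)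
    have := intervalIntegral.sub_le_integral_of_hasDeriv_right_of_le hd.le
      (fun x hx => (hder x hx).continuousAt.continuousWithinAt)
      (fun x hx => (hder x (Ioo_subset_Icc_self hx)).hasDerivWithinAt)
      (c3.integrableOn_Icc)
      (fun x _ => by nlinarith [sq_nonneg (f' x - k)])
    refine le_trans (le_of_eq ?_) this
    rw [hf0, hk]; field_simp; ring
  have hmain : l * (f d ^ 2 / d) ≤
      ∫ x in (0 : ℝ)..d, (f' x ^ 2 - (A * s x ^ 2 + B * (x ^ m * s x ^ 2))) := by
    have hder : ∀ x ∈ Ioo 0 d, HasDerivAt (fun x => W x * (x * s x ^ 2))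
        (((W' x * f x ^ 2 + W x * (2 * f x * f' x)) * x - W x * f x ^ 2 * 1) / x ^ 2) x := by
      intro x hx
      have h1 : HasDerivAt (fun x => W x * f x ^ 2 / x)
          (((W' x * f x ^ 2 + W x * (2 * f x * f' x)) * x - W x * f x ^ 2 * 1) / x ^ 2) x := by
        have h2 : HasDerivAt (fun x => f x ^ 2) (2 * f x * f' x) x := by
          exact ((hf x (Ioo_subset_Icc_self hx)).fun_pow 2).congr_deriv (by ring)
        exact ((hW x hx).mul h2).div (hasDerivAt_id x) hx.1.ne'
      refine h1.congr_of_eventuallyEq ?_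
      filter_upwards [lt_mem_nhds hx.1] with z hz
      rw [hfs z]; field_simp
    have := intervalIntegral.sub_le_integral_of_hasDeriv_right_of_le hd.le
      (hWc.mul (continuousOn_id.mul c1))
      (fun x hx => (hder x hx).hasDerivWithinAt)
      (c3.sub ((c1.const_mul A).add (c2.const_mul B))).integrableOn_Icc
      (fun x hx => by
        have hx0 := hx.1.ne'
        have hr := hric x hx
        have : ((W' x * f x ^ 2 + W x * (2 * f x * f' x)) * x - W x * f x ^ 2 * 1) / x ^ 2
            = f' x ^ 2 - (A * s x ^ 2 + B * (x ^ m * s x ^ 2)) - (f' x - W x * s x) ^ 2 := by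
          rw [hfs x, div_eq_iff (by positivity)]
          linear_combination (x ^ 2 * s x ^ 2) * hr
        rw [this]
        simp only [Pi.sub_apply, Pi.add_apply]
        linarith [sq_nonneg (f' x - W x * s x)])
    refine le_trans (le_of_eq ?_) this
    simp only [Pi.mul_apply, id]
    rw [hWd, hfs d]; field_simp; ring
  rw [intervalIntegral.integral_sub i3 ((i1.const_mul A).add (i2.const_mul B)),
    intervalIntegral.integral_add (i1.const_mul A) (i2.const_mul B),
    intervalIntegral.integral_const_mul, intervalIntegral.integral_const_mul] at hmain
  rw [abs_of_nonpos hl]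
  nlinarith

/-- The logarithmic derivative of `√x J_ν((2c/m) (x/d)^{m/2})`, multiplied by `x`, solves the
Riccati equation required by `hardy_of_riccati`. -/
lemma exists_bessel_riccati {m ν lam c jν d : ℝ} (hm : 0 < m) (hν : 0 ≤ ν) (hd : 0 < d)
    (hjν_first : ∀ t ∈ Set.Ioo 0 jν, 0 < besselJ ν t)
    (hcm : 2 * c / m ∈ Set.Ioo 0 jν)
    (hroot : (1 - 2 * lam) * besselJ ν (2 * c / m)
      + 2 * c * deriv (besselJ ν) (2 * c / m) = 0) :
    ∃ W W' : ℝ → ℝ, ContinuousOn W (Icc 0 d) ∧ (∀ x ∈ Ioo 0 d, HasDerivAt W (W' x) x) ∧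
      (∀ x ∈ Ioo 0 d, x * W' x - W x + W x ^ 2 =
        -((1 - ν ^ 2 * m ^ 2) / 4 + c ^ 2 / d ^ m * x ^ m)) ∧ W d = lam := by
  obtain ⟨h', h'', hh, hh', hode⟩ := exists_hasDerivAt_besselEntire hν
  set h := besselEntire ν with hdef
  set β := 2 * c / m with hβ
  have hβ0 : 0 < β := hcm.1
  have hdm : 0 < d ^ m := Real.rpow_pos_of_pos hd m
  set K := β ^ 2 / d ^ m with hK
  have hpos : ∀ y ∈ Icc 0 (β ^ 2), 0 < h y := by
    intro y hy
    rcases hy.1.eq_or_lt with rfl | hy0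
    · exact besselEntire_zero_pos hν
    have hs : 0 < √y := Real.sqrt_pos.2 hy0
    have h1 := hjν_first (√y) ⟨hs, (Real.sqrt_le_iff.2 ⟨hβ0.le, hy.2⟩).trans_lt hcm.2⟩
    rw [besselJ_eq_rpow_mul hs, Real.sq_sqrt hy.1] at h1
    exact pos_of_mul_pos_right h1 (by positivity)
  have hmem : ∀ x ∈ Icc 0 d, K * x ^ m ∈ Icc 0 (β ^ 2) := by
    intro x hx
    have h1 : x ^ m ≤ d ^ m := Real.rpow_le_rpow hx.1 hx.2 hm.le
    have h0 : 0 ≤ x ^ m := Real.rpow_nonneg hx.1 m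
    refine ⟨by positivity, ?_⟩
    calc K * x ^ m ≤ K * d ^ m := by gcongr
      _ = β ^ 2 := by rw [hK]; field_simp
  have hP : ∀ y ∈ Icc 0 (β ^ 2), HasDerivAt (fun y => y * h' y / h y)
      (((1 * h' y + y * h'' y) * h y - y * h' y * h' y) / h y ^ 2) y := fun y hy =>
    ((hasDerivAt_id y).mul (hh' y)).div (hh y) (hpos y hy).ne'
  have hxm : Continuous fun x : ℝ => K * x ^ m :=
    continuous_const.mul (Real.continuous_rpow_const hm.le)
  refine ⟨fun x => 1 / 2 + ν * m / 2 + m * ((K * x ^ m) * h' (K * x ^ m) / h (K * x ^ m)),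
    fun x => m * ((((1 * h' (K * x ^ m) + (K * x ^ m) * h'' (K * x ^ m)) * h (K * x ^ m)
      - (K * x ^ m) * h' (K * x ^ m) * h' (K * x ^ m)) / h (K * x ^ m) ^ 2)
      * (K * (m * x ^ (m - 1)))), ?_, ?_, ?_, ?_⟩
  · intro x hx
    have h1 : ContinuousAt (fun x => (K * x ^ m) * h' (K * x ^ m) / h (K * x ^ m)) x :=
      ContinuousAt.comp (f := fun x : ℝ => K * x ^ m) (g := fun y => y * h' y / h y)
        (hP _ (hmem x hx)).continuousAt hxm.continuousAt
    exact (continuousAt_const.add (continuousAt_const.mul h1)).continuousWithinAt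
  · intro x hx
    have h1 : HasDerivAt (fun x : ℝ => K * x ^ m) (K * (m * x ^ (m - 1))) x :=
      (Real.hasDerivAt_rpow_const (Or.inl hx.1.ne')).const_mul K
    have h2 := HasDerivAt.comp x (hP _ (hmem x (Ioo_subset_Icc_self hx))) h1
    exact (h2.const_mul m).const_add _
  · intro x hx
    have hx0 := hx.1.ne'
    have hhy := (hpos _ (hmem x (Ioo_subset_Icc_self hx))).ne'
    have ho := hode (K * x ^ m)
    have hKc : c ^ 2 / d ^ m * x ^ m = m ^ 2 * (K * x ^ m) / 4 := by
      rw [hK, hβ]; field_simp; ring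
    have hx1 : x ^ (m - 1) = x ^ m / x := Real.rpow_sub_one hx0 m
    rw [hKc]
    simp only [hx1]
    have hy : x * (K * (m * (x ^ m / x))) = m * (K * x ^ m) := by field_simp
    generalize K * x ^ m = y at *
    rw [show ∀ a b : ℝ, x * (m * (a * b)) = m * a * (x * b) from fun a b => by ring, hy]
    field_simp
    linear_combination (4 * m ^ 2 * y * h y) * ho
  · have hKd : K * d ^ m = β ^ 2 := by rw [hK]; field_simp
    have hpp : 0 < (β / 2) ^ ν := by positivity
    have hhb := hpos (β ^ 2) ⟨by positivity, le_rfl⟩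
    have hd' := deriv_besselJ_mul hβ0 (hh (β ^ 2))
    have h2c : 2 * c = m * β := by rw [hβ]; field_simp
    rw [h2c, mul_assoc, hd', besselJ_eq_rpow_mul hβ0] at hroot
    have hr : (1 - 2 * lam) * h (β ^ 2) + m * (ν * h (β ^ 2) + 2 * β ^ 2 * h' (β ^ 2)) = 0 := by
      refine (mul_eq_zero.1 (?_ : (β / 2) ^ ν * _ = 0)).resolve_left hpp.ne'
      linear_combination hroot
    simp only [hKd]
    field_simp
    linear_combination hr

/-- An integral over `(a, b)` split at the midpoint, each half parametrized by the distance to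
its endpoint. -/
lemma setIntegral_Ioo_eq_add_of_half {a b : ℝ} {u uL uR : ℝ → ℝ} (hab : a < b)
    (hL : IntervalIntegrable uL volume 0 ((b - a) / 2))
    (hR : IntervalIntegrable uR volume 0 ((b - a) / 2))
    (huL : ∀ x ∈ Ioc 0 ((b - a) / 2), u (a + x) = uL x)
    (huR : ∀ x ∈ Ioc 0 ((b - a) / 2), u (b - x) = uR x) :
    ∫ x in Ioo a b, u x =
      (∫ x in (0 : ℝ)..((b - a) / 2), uL x) + ∫ x in (0 : ℝ)..((b - a) / 2), uR x := by
  have hd : 0 ≤ (b - a) / 2 := by linarith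
  have hL' : IntervalIntegrable (fun x => u (a + x)) volume 0 ((b - a) / 2) :=
    hL.congr (by rw [uIoc_of_le hd]; exact fun x hx => (huL x hx).symm)
  have hR' : IntervalIntegrable (fun x => u (b - x)) volume 0 ((b - a) / 2) :=
    hR.congr (by rw [uIoc_of_le hd]; exact fun x hx => (huR x hx).symm)
  have IL : IntervalIntegrable u volume a (a + (b - a) / 2) := by
    simpa [add_comm] using hL'.comp_sub_right a
  have IR : IntervalIntegrable u volume (a + (b - a) / 2) b := by
    have h := (hR'.comp_sub_left b).symm
    rw [show b - (b - a) / 2 = a + (b - a) / 2 by ring] at h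
    simpa using h
  rw [← integral_Ioc_eq_integral_Ioo, ← intervalIntegral.integral_of_le hab.le,
    ← intervalIntegral.integral_add_adjacent_intervals IL IR]
  congr 1
  · rw [← intervalIntegral.integral_congr_Ioo_of_le hd
        (fun x hx => huL x (Ioo_subset_Ioc_self hx)), intervalIntegral.integral_comp_add_left,
      add_zero]
  · rw [← intervalIntegral.integral_congr_Ioo_of_le hd
        (fun x hx => huR x (Ioo_subset_Ioc_self hx)), intervalIntegral.integral_comp_sub_left,
      sub_zero, show b - (b - a) / 2 = a + (b - a) / 2 by ring]

theorem stmt_15 (m ν lam c jν a b : ℝ) (g g' : ℝ → ℝ)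
    (hm : 0 < m) (hν : ν ∈ Set.Ico 0 (1 / m))
    (hlam : lam ≤ 0)
    (hc : 0 < c)
    (hjν_pos : 0 < jν) (hjν_zero : besselJ ν jν = 0)
    (hjν_first : ∀ t ∈ Set.Ioo 0 jν, 0 < besselJ ν t)
    (hcm : 2 * c / m ∈ Set.Ioo 0 jν)
    (hroot : (1 - 2 * lam) * besselJ ν (2 * c / m)
      + 2 * c * deriv (besselJ ν) (2 * c / m) = 0)
    (hab : a < b)
    (hg : ∀ x ∈ Set.Icc a b, HasDerivAt g (g' x) x)
    (hg' : ContinuousOn g' (Set.Icc a b))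
    (hga : g a = 0) (hgb : g b = 0) :
    (1 - ν ^ 2 * m ^ 2) / 4 * (∫ x in Set.Ioo a b, |g x| ^ 2 / (min (b - x) (x - a)) ^ 2)
      + c ^ 2 / ((b - a) / 2) ^ m *
        (∫ x in Set.Ioo a b, |g x| ^ 2 / (min (b - x) (x - a)) ^ ((2:ℝ) - m))
    ≤ (2 * (1 + ν * m) + |lam|) * (∫ x in Set.Ioo a b, |g' x| ^ 2) := by
  set d := (b - a) / 2 with hd_def
  have hd : 0 < d := by rw [hd_def]; linarith
  obtain ⟨W, W', hWc, hW, hric, hWd⟩ :=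
    exists_bessel_riccati hm hν.1 hd hjν_first hcm hroot
  have hL := hardy_of_riccati (f := fun x => g (a + x)) (f' := fun x => g' (a + x)) hd hm hlam
    hWc hW hric hWd
    (fun x hx => by
      simpa using HasDerivAt.comp_const_add a x
        (hg (a + x) ⟨by linarith [hx.1], by linarith [hx.2]⟩))
    (hg'.comp (by fun_prop) fun x hx => ⟨by linarith [hx.1], by linarith [hx.2]⟩)
    (by simpa using hga)
  have hR := hardy_of_riccati (f := fun x => g (b - x)) (f' := fun x => -g' (b - x)) hd hm hlam
    hWc hW hric hWd
    (fun x hx => by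
      simpa using HasDerivAt.comp_const_sub b x
        (hg (b - x) ⟨by linarith [hx.2], by linarith [hx.1]⟩))
    (hg'.comp (by fun_prop) fun x hx => ⟨by linarith [hx.2], by linarith [hx.1]⟩).neg
    (by simpa using hgb)
  simp only [abs_neg] at hR
  obtain ⟨hL1, hL2, hL3⟩ := hL
  obtain ⟨hR1, hR2, hR3⟩ := hR
  have hLi : IntervalIntegrable (fun x => |g' (a + x)| ^ 2) volume 0 d :=
    ContinuousOn.intervalIntegrable_of_Icc hd.le <| ContinuousOn.pow (ContinuousOn.abs <|
      hg'.comp (by fun_prop) fun x hx => ⟨by linarith [hx.1], by linarith [hx.2]⟩) 2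
  have hRi : IntervalIntegrable (fun x => |g' (b - x)| ^ 2) volume 0 d :=
    ContinuousOn.intervalIntegrable_of_Icc hd.le <| ContinuousOn.pow (ContinuousOn.abs <|
      hg'.comp (by fun_prop) fun x hx => ⟨by linarith [hx.2], by linarith [hx.1]⟩) 2
  have minL : ∀ x ∈ Ioc 0 d, min (b - (a + x)) (a + x - a) = x := fun x hx => by
    rw [min_eq_right (by linarith [hx.2]), add_sub_cancel_left]
  have minR : ∀ x ∈ Ioc 0 d, min (b - (b - x)) (b - x - a) = x := fun x hx => by
    rw [min_eq_left (by linarith [hx.2]), sub_sub_cancel]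
  rw [setIntegral_Ioo_eq_add_of_half hab hL1 hR1
      (fun x hx => by rw [minL x hx]) (fun x hx => by rw [minR x hx]),
    setIntegral_Ioo_eq_add_of_half hab hL2 hR2
      (fun x hx => by rw [minL x hx]) (fun x hx => by rw [minR x hx]),
    setIntegral_Ioo_eq_add_of_half hab hLi hRi (fun x _ => rfl) (fun x _ => rfl)]
  have nL : 0 ≤ ∫ x in (0 : ℝ)..d, |g' (a + x)| ^ 2 :=
    intervalIntegral.integral_nonneg hd.le fun x _ => by positivity
  have nR : 0 ≤ ∫ x in (0 : ℝ)..d, |g' (b - x)| ^ 2 :=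
    intervalIntegral.integral_nonneg hd.le fun x _ => by positivity
  have hνm : 0 ≤ ν * m := mul_nonneg hν.1 hm.le
  nlinarith [mul_nonneg hνm nL, mul_nonneg hνm nR]
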